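/- arXiv:1904.07196 — 3 statements merged into one kernel-verified Lean document; each statement's English description precedes it below -/
import Mathlib

section
/- Let I be a nonempty open real interval, let f, g: I → ℝ be continuous strictly monotone functions, let n ≥ 2, let k ∈ ℕ, and let p = (p_1,…,p_n): I → ℝ_+^n and q = (q_1,…,q_n): I → ℝ_+^n. Assume there exists an open set U ⊆ I^n containing the diagonal diag(I^n) such that A_{f,p} = A_{g,q} on U, and assume that f and g are k times differentiable (respectively, k times continuously differentiable) on I with nonvanishing first derivatives. Then for every i ∈ {1,…,n}, the function p_i is k times differentiable (respectively, k times continuously differentiable) on I if and only if q_i is k times differentiable (respectively, k times continuously differentiable) on I. -/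
/-- `f` is `k` times differentiable on the (open) set `I`. -/
def KTimesDiffOn (k : ℕ) (f : ℝ → ℝ) (I : Set ℝ) : Prop :=
  ∀ m < k, DifferentiableOn ℝ (deriv^[m] f) I

open Set Filter Topology

/-- `f` is `k` times differentiable on `s` and, when `c` holds, its `k`-th derivative is
continuous on `s`. -/
def IterDiffOn (c : Prop) : ℕ → (ℝ → ℝ) → Set ℝ → Prop
  | 0, f, s => c → ContinuousOn f s
  | k + 1, f, s => DifferentiableOn ℝ f s ∧ IterDiffOn c k (deriv f) s

namespace IterDiffOn

variable {c : Prop} {k : ℕ} {f g : ℝ → ℝ} {s t : Set ℝ}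

theorem of_succ (h : IterDiffOn c (k + 1) f s) : IterDiffOn c k f s := by
  induction k generalizing f with
  | zero => exact fun _ => h.1.continuousOn
  | succ k ih => exact ⟨h.1, ih h.2⟩

theorem continuousOn (hk : 1 ≤ k) (h : IterDiffOn c k f s) : ContinuousOn f s := by
  obtain ⟨m, rfl⟩ := Nat.exists_eq_add_of_le' hk
  exact h.1.continuousOn

theorem mono (h : IterDiffOn c k f s) (hts : t ⊆ s) : IterDiffOn c k f t := by
  induction k generalizing f with
  | zero => exact fun hc => (h hc).mono hts
  | succ k ih => exact ⟨h.1.mono hts, ih h.2⟩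

theorem congr (hs : IsOpen s) (h : IterDiffOn c k f s) (hfg : EqOn g f s) :
    IterDiffOn c k g s := by
  induction k generalizing f g with
  | zero => exact fun hc => (h hc).congr hfg
  | succ k ih => exact ⟨h.1.congr hfg, ih h.2 (hfg.deriv hs)⟩

theorem of_locally (h : ∀ x ∈ s, ∃ u, IsOpen u ∧ x ∈ u ∧ IterDiffOn c k f u) :
    IterDiffOn c k f s := by
  induction k generalizing f with
  | zero =>
    intro hc x hx
    obtain ⟨u, hu, hxu, hfu⟩ := h x hx
    exact ((hfu hc).continuousAt (hu.mem_nhds hxu)).continuousWithinAt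
  | succ k ih =>
    refine ⟨fun x hx => ?_, ih fun x hx => ?_⟩
    · obtain ⟨u, hu, hxu, hfu⟩ := h x hx
      exact (hfu.1.differentiableAt (hu.mem_nhds hxu)).differentiableWithinAt
    · obtain ⟨u, hu, hxu, hfu⟩ := h x hx
      exact ⟨u, hu, hxu, hfu.2⟩

theorem const (a : ℝ) : IterDiffOn c k (fun _ => a) s := by
  induction k generalizing a with
  | zero => exact fun _ => continuousOn_const
  | succ k ih =>
    refine ⟨differentiableOn_const a, ?_⟩
    have : deriv (fun _ : ℝ => a) = fun _ => 0 := by ext x; simp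
    rw [this]
    exact ih 0

theorem add (hs : IsOpen s) (hf : IterDiffOn c k f s) (hg : IterDiffOn c k g s) :
    IterDiffOn c k (fun x => f x + g x) s := by
  induction k generalizing f g with
  | zero => exact fun hc => (hf hc).add (hg hc)
  | succ k ih =>
    refine ⟨hf.1.add hg.1, (ih hf.2 hg.2).congr hs fun x hx => ?_⟩
    exact ((hf.1.differentiableAt (hs.mem_nhds hx)).hasDerivAt.add
      (hg.1.differentiableAt (hs.mem_nhds hx)).hasDerivAt).deriv

theorem mul (hs : IsOpen s) (hf : IterDiffOn c k f s) (hg : IterDiffOn c k g s) :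
    IterDiffOn c k (fun x => f x * g x) s := by
  induction k generalizing f g with
  | zero => exact fun hc => (hf hc).mul (hg hc)
  | succ k ih =>
    refine ⟨hf.1.mul hg.1,
      ((ih hf.2 hg.of_succ).add hs (ih hf.of_succ hg.2)).congr hs fun x hx => ?_⟩
    exact ((hf.1.differentiableAt (hs.mem_nhds hx)).hasDerivAt.mul
      (hg.1.differentiableAt (hs.mem_nhds hx)).hasDerivAt).deriv

theorem neg (hs : IsOpen s) (hf : IterDiffOn c k f s) : IterDiffOn c k (fun x => -f x) s :=
  ((const (-1)).mul hs hf).congr hs fun x _ => by ring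

theorem sub (hs : IsOpen s) (hf : IterDiffOn c k f s) (hg : IterDiffOn c k g s) :
    IterDiffOn c k (fun x => f x - g x) s :=
  (hf.add hs (hg.neg hs)).congr hs fun x _ => by ring

theorem inv (hs : IsOpen s) (hf : IterDiffOn c k f s) (h0 : ∀ x ∈ s, f x ≠ 0) :
    IterDiffOn c k (fun x => (f x)⁻¹) s := by
  induction k with
  | zero => exact fun hc => (hf hc).inv₀ h0
  | succ k ih =>
    have hi := ih hf.of_succ
    refine ⟨hf.1.inv h0, ((hf.2.neg hs).mul hs (hi.mul hs hi)).congr hs fun x hx => ?_⟩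
    rw [((hf.1.differentiableAt (hs.mem_nhds hx)).hasDerivAt.fun_inv (h0 x hx)).deriv]
    have := h0 x hx
    field_simp

theorem div (hs : IsOpen s) (hf : IterDiffOn c k f s) (hg : IterDiffOn c k g s)
    (h0 : ∀ x ∈ s, g x ≠ 0) : IterDiffOn c k (fun x => f x / g x) s :=
  (hf.mul hs (hg.inv hs h0)).congr hs fun _ _ => div_eq_mul_inv _ _

theorem comp (hs : IsOpen s) (ht : IsOpen t) (hf : IterDiffOn c k f t)
    (hg : IterDiffOn c k g s) (hst : MapsTo g s t) : IterDiffOn c k (fun x => f (g x)) s := by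
  induction k generalizing f with
  | zero => exact fun hc => (hf hc).comp (hg hc) hst
  | succ k ih =>
    refine ⟨hf.1.comp hg.1 hst, ((ih hf.2 hg.of_succ).mul hs hg.2).congr hs fun x hx => ?_⟩
    exact ((hf.1.differentiableAt (ht.mem_nhds (hst hx))).hasDerivAt.comp x
      (hg.1.differentiableAt (hs.mem_nhds hx)).hasDerivAt).deriv

end IterDiffOn

theorem kTimesDiffOn_iff_iterDiffOn {k : ℕ} {f : ℝ → ℝ} {s : Set ℝ} :
    KTimesDiffOn k f s ↔ IterDiffOn False k f s := by
  induction k generalizing f with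
  | zero => simp [KTimesDiffOn, IterDiffOn]
  | succ k ih =>
    rw [IterDiffOn, ← ih]
    constructor
    · exact fun h => ⟨h 0 k.succ_pos, fun m hm => h (m + 1) (Nat.succ_lt_succ hm)⟩
    · rintro ⟨h0, h⟩ (_ | m) hm
      · exact h0
      · exact h m (Nat.lt_of_succ_lt_succ hm)

theorem contDiffOn_iff_iterDiffOn {k : ℕ} {f : ℝ → ℝ} {s : Set ℝ} (hs : IsOpen s) :
    ContDiffOn ℝ k f s ↔ IterDiffOn True k f s := by
  induction k generalizing f with
  | zero => simp [IterDiffOn]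
  | succ k ih =>
    rw [IterDiffOn, ← ih, Nat.cast_succ, contDiffOn_succ_iff_deriv_of_isOpen hs]
    simp

/-- A function `m` solving `f (m u) = h u` is differentiable if `h` is, provided that `f` has a
nonvanishing derivative. -/
theorem hasDerivAt_of_comp_eventuallyEq {f m h : ℝ → ℝ} {u f' h' : ℝ}
    (hf : HasDerivAt f f' (m u)) (hf' : f' ≠ 0) (hm : ContinuousAt m u)
    (hh : HasDerivAt h h' u) (hfm : ∀ᶠ v in 𝓝 u, f (m v) = h v) :
    HasDerivAt m (h' / f') u := by
  rw [hasDerivAt_iff_tendsto_slope] at hh ⊢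
  have hd : ContinuousAt (dslope f (m u)) (m u) :=
    continuousAt_dslope_same.2 hf.differentiableAt
  have hlim : Tendsto (fun v => dslope f (m u) (m v)) (𝓝[≠] u) (𝓝 f') := by
    have := hd.tendsto.comp hm.tendsto
    rw [dslope_same, hf.deriv] at this
    exact this.mono_left nhdsWithin_le_nhds
  refine (hh.div hlim hf').congr' ?_
  filter_upwards [hlim.eventually_ne hf', nhdsWithin_le_nhds hfm] with v hv hfv
  have key : (m v - m u) * dslope f (m u) (m v) = h v - h u := by
    rw [← hfv, ← hfm.self_of_nhds, ← smul_eq_mul, sub_smul_dslope]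
  rw [Pi.div_apply, slope_def_field, slope_def_field, ← key]
  field_simp

theorem IterDiffOn.of_comp_eqOn {c : Prop} {k : ℕ} {f m h : ℝ → ℝ} {s t : Set ℝ}
    (hs : IsOpen s) (ht : IsOpen t) (hf : IterDiffOn c k f t) (hf' : ∀ x ∈ t, deriv f x ≠ 0)
    (hm : ContinuousOn m s) (hst : MapsTo m s t) (hh : IterDiffOn c k h s)
    (hfm : ∀ u ∈ s, f (m u) = h u) : IterDiffOn c k m s := by
  induction k with
  | zero => exact fun _ => hm
  | succ k ih =>
    have hder : ∀ u ∈ s, HasDerivAt m (deriv h u / deriv f (m u)) u := fun u hu =>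
      hasDerivAt_of_comp_eventuallyEq
        (hf.1.differentiableAt (ht.mem_nhds (hst hu))).hasDerivAt (hf' _ (hst hu))
        (hm.continuousAt (hs.mem_nhds hu)) (hh.1.differentiableAt (hs.mem_nhds hu)).hasDerivAt
        (eventually_of_mem (hs.mem_nhds hu) hfm)
    refine ⟨fun u hu => (hder u hu).differentiableAt.differentiableWithinAt, ?_⟩
    exact (hh.2.div hs (hf.2.comp hs ht (ih hf.of_succ hh.of_succ) hst)
      fun u hu => hf' _ (hst hu)).congr hs fun u hu => (hder u hu).deriv

theorem StrictMonoOn.continuousOn_of_comp_eqOn {f m h : ℝ → ℝ} {s t : Set ℝ}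
    (hf : StrictMonoOn f t) (ht : IsOpen t) (hst : MapsTo m s t) (hh : ContinuousOn h s)
    (hfm : ∀ u ∈ s, f (m u) = h u) : ContinuousOn m s := by
  intro u hu
  obtain ⟨ε, hε, hball⟩ := Metric.isOpen_iff.1 ht _ (hst hu)
  have hmem : ∀ y, |y - m u| < ε → y ∈ t := fun y hy =>
    hball (by rwa [Metric.mem_ball, Real.dist_eq])
  refine tendsto_order.2 ⟨fun a ha => ?_, fun a ha => ?_⟩
  · obtain ⟨b, hb, hbu⟩ := exists_between (max_lt ha (sub_lt_self (m u) hε))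
    rw [max_lt_iff] at hb
    have hbt : b ∈ t := hmem b (abs_lt.2 ⟨by linarith, by linarith⟩)
    have hlt : f b < h u := hfm u hu ▸ hf hbt (hst hu) hbu
    filter_upwards [(hh u hu).eventually_const_lt hlt, self_mem_nhdsWithin] with v hv hvs
    rw [← hfm v hvs, hf.lt_iff_lt hbt (hst hvs)] at hv
    exact hb.1.trans hv
  · obtain ⟨b, hub, hb⟩ := exists_between (lt_min ha (lt_add_of_pos_right (m u) hε))
    rw [lt_min_iff] at hb
    have hbt : b ∈ t := hmem b (abs_lt.2 ⟨by linarith, by linarith⟩)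
    have hlt : h u < f b := hfm u hu ▸ hf (hst hu) hbt hub
    filter_upwards [(hh u hu).eventually_lt_const hlt, self_mem_nhdsWithin] with v hv hvs
    rw [← hfm v hvs, hf.lt_iff_lt (hst hvs) hbt] at hv
    exact hv.trans hb.1

theorem continuousOn_of_strict_comp_eqOn {f m h : ℝ → ℝ} {s t : Set ℝ}
    (hf : StrictMonoOn f t ∨ StrictAntiOn f t) (ht : IsOpen t) (hst : MapsTo m s t)
    (hh : ContinuousOn h s) (hfm : ∀ u ∈ s, f (m u) = h u) : ContinuousOn m s := by
  rcases hf with hf | hf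
  · exact hf.continuousOn_of_comp_eqOn ht hst hh hfm
  · exact hf.neg.continuousOn_of_comp_eqOn ht hst hh.neg fun u hu => congrArg Neg.neg (hfm u hu)

theorem mapsTo_and_rightInverse_of_convex_image {f finv : ℝ → ℝ} {I : Set ℝ}
    (hI : I.OrdConnected) (hf : ContinuousOn f I) (hleft : ∀ x ∈ I, finv (f x) = x)
    {a b x y : ℝ} (ha : 0 < a) (hb : 0 < b) (hx : x ∈ I) (hy : y ∈ I) :
    finv ((a * f x + b * f y) / (a + b)) ∈ I ∧
      f (finv ((a * f x + b * f y) / (a + b))) = (a * f x + b * f y) / (a + b) := by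
  have hconv : Convex ℝ (f '' I) := (hI.isPreconnected.image f hf).ordConnected.convex
  have hmem := convex_iff_div.1 hconv (mem_image_of_mem f hx) (mem_image_of_mem f hy)
    ha.le hb.le (add_pos ha hb)
  have heq : (a / (a + b)) • f x + (b / (a + b)) • f y = (a * f x + b * f y) / (a + b) := by
    simp only [smul_eq_mul]
    ring
  rw [heq] at hmem
  obtain ⟨w, hw, hfw⟩ := hmem
  rw [← hfw, hleft w hw]
  exact ⟨hw, rfl⟩

theorem sum_update_const {n : ℕ} (F : Fin n → ℝ → ℝ) (i : Fin n) (x u : ℝ) :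
    ∑ j, F j (Function.update (Function.const (Fin n) x) i u j) =
      F i u + ∑ j ∈ Finset.univ.erase i, F j x := by
  rw [← Finset.add_sum_erase _ _ (Finset.mem_univ i), Function.update_self]
  congr 1
  refine Finset.sum_congr rfl fun j hj => ?_
  rw [Function.update_of_ne (Finset.ne_of_mem_erase hj), Function.const_apply]

theorem sum_erase_pos {n : ℕ} (hn : 2 ≤ n) {p : Fin n → ℝ → ℝ} {x : ℝ} (hp : ∀ i, 0 < p i x)
    (i : Fin n) : 0 < ∑ j ∈ Finset.univ.erase i, p j x := by
  refine Finset.sum_pos (fun j _ => hp j) (Finset.card_pos.1 ?_)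
  rw [Finset.card_erase_of_mem (Finset.mem_univ i), Finset.card_univ, Fintype.card_fin]
  omega

/-- Regularity of a weight passes from one Bajraktarević mean to another one that agrees with it
near the diagonal. -/
theorem IterDiffOn.weight_of_means_eq {c : Prop} {k n : ℕ} (hk : 1 ≤ k) (hn : 2 ≤ n)
    {I : Set ℝ} (hIopen : IsOpen I) (hIconn : I.OrdConnected)
    {f g finvf finvg : ℝ → ℝ} (hfc : ContinuousOn f I) (hgc : ContinuousOn g I)
    (hf : StrictMonoOn f I ∨ StrictAntiOn f I) (hg : InjOn g I)
    (hfleft : ∀ x ∈ I, finvf (f x) = x) (hgleft : ∀ x ∈ I, finvg (g x) = x)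
    {p q : Fin n → ℝ → ℝ}
    (hp : ∀ i, ∀ x ∈ I, 0 < p i x) (hq : ∀ i, ∀ x ∈ I, 0 < q i x)
    {U : Set (Fin n → ℝ)} (hUopen : IsOpen U)
    (hUdiag : ∀ x ∈ I, Function.const (Fin n) x ∈ U)
    (heq : ∀ y ∈ U,
      finvf ((∑ i, p i (y i) * f (y i)) / (∑ i, p i (y i))) =
      finvg ((∑ i, q i (y i) * g (y i)) / (∑ i, q i (y i))))
    (hf' : ∀ x ∈ I, deriv f x ≠ 0) (hfk : IterDiffOn c k f I) (hgk : IterDiffOn c k g I)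
    {i : Fin n} (hpi : IterDiffOn c k (p i) I) : IterDiffOn c k (q i) I := by
  refine IterDiffOn.of_locally fun u₀ hu₀ => ?_
  obtain ⟨x, hxI, hxU, hxne⟩ :
      ∃ x ∈ I, Function.update (Function.const (Fin n) x) i u₀ ∈ U ∧ x ≠ u₀ := by
    have hcont : Continuous fun x : ℝ => Function.update (Function.const (Fin n) x) i u₀ :=
      (continuous_pi fun _ => continuous_id).update i continuous_const
    have hev : ∀ᶠ x in 𝓝 u₀, Function.update (Function.const (Fin n) x) i u₀ ∈ U := by
      refine hcont.continuousAt.eventually_mem (hUopen.mem_nhds ?_)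
      convert hUdiag u₀ hu₀
      exact Function.update_eq_self i (Function.const (Fin n) u₀)
    obtain ⟨x, ⟨hx₁, hx₂⟩, hx₃⟩ :=
      ((((hIopen.eventually_mem hu₀).and hev).filter_mono nhdsWithin_le_nhds).and
        (self_mem_nhdsWithin : {u₀}ᶜ ∈ 𝓝[≠] u₀)).exists
    exact ⟨x, hx₁, hx₂, hx₃⟩
  set V : Set ℝ :=
    I ∩ ((fun u => Function.update (Function.const (Fin n) x) i u) ⁻¹' U ∩ {x}ᶜ) with hV
  have hVopen : IsOpen V := hIopen.inter
    ((hUopen.preimage (continuous_const.update i continuous_id)).inter isOpen_compl_singleton)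
  have hVI : V ⊆ I := inter_subset_left
  refine ⟨V, hVopen, ⟨hu₀, hxU, hxne.symm⟩, ?_⟩
  set a := ∑ j ∈ Finset.univ.erase i, p j x
  set b := ∑ j ∈ Finset.univ.erase i, q j x
  have ha : 0 < a := sum_erase_pos hn (fun j => hp j x hxI) i
  have hb : 0 < b := sum_erase_pos hn (fun j => hq j x hxI) i
  set h : ℝ → ℝ := fun u => (p i u * f u + a * f x) / (p i u + a) with hh
  set m : ℝ → ℝ := fun u => finvf (h u) with hm
  have hm_eq : ∀ u ∈ V, m u = finvg ((q i u * g u + b * g x) / (q i u + b)) := by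
    intro u hu
    have := heq _ hu.2.1
    rw [sum_update_const (fun j y => p j y * f y), sum_update_const p,
      sum_update_const (fun j y => q j y * g y), sum_update_const q,
      ← Finset.sum_mul, ← Finset.sum_mul] at this
    exact this
  have hfm : ∀ u ∈ V, m u ∈ I ∧ f (m u) = h u := fun u hu =>
    mapsTo_and_rightInverse_of_convex_image hIconn hfc hfleft (hp i u (hVI hu)) ha (hVI hu) hxI
  have hgm : ∀ u ∈ V, g (m u) = (q i u * g u + b * g x) / (q i u + b) := fun u hu => by
    rw [hm_eq u hu]
    exact (mapsTo_and_rightInverse_of_convex_image hIconn hgc hgleft (hq i u (hVI hu)) hb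
      (hVI hu) hxI).2
  have hpV := hpi.mono hVI
  have hhk : IterDiffOn c k h V :=
    ((hpV.mul hVopen (hfk.mono hVI)).add hVopen (const _)).div hVopen
      (hpV.add hVopen (const _)) fun u hu => (add_pos (hp i u (hVI hu)) ha).ne'
  have hmaps : MapsTo m V I := fun u hu => (hfm u hu).1
  have hmc : ContinuousOn m V := continuousOn_of_strict_comp_eqOn hf hIopen hmaps
    (hhk.continuousOn hk) fun u hu => (hfm u hu).2
  have hmk : IterDiffOn c k m V :=
    IterDiffOn.of_comp_eqOn hVopen hIopen hfk hf' hmc hmaps hhk fun u hu => (hfm u hu).2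
  have hgmk : IterDiffOn c k (fun u => g (m u)) V := hgk.comp hVopen hIopen hmk hmaps
  have hrel : ∀ u ∈ V, q i u * (g (m u) - g u) = b * (g x - g (m u)) := fun u hu => by
    have := add_pos (hq i u (hVI hu)) hb
    rw [hgm u hu]
    field_simp
    ring
  have hne : ∀ u ∈ V, g (m u) - g u ≠ 0 := fun u hu h0 => by
    have h1 := hrel u hu
    rw [h0, mul_zero, eq_comm, mul_eq_zero, or_iff_right hb.ne'] at h1
    exact hu.2.2 (hg (hVI hu) hxI (by linarith))
  exact (((const b).mul hVopen ((const (g x)).sub hVopen hgmk)).div hVopen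
    (hgmk.sub hVopen (hgk.mono hVI)) hne).congr hVopen fun u hu =>
      eq_div_of_mul_eq (hne u hu) (hrel u hu)

/-- Lemma reg (ii): if `A_{f,p} = A_{g,q}` on an open set `U ⊆ Iⁿ` containing
the diagonal and `f, g` are `k` times differentiable (resp. `k` times
continuously differentiable) with nonvanishing first derivatives, then `pᵢ` is
`k` times differentiable (resp. `k` times continuously differentiable) on `I`
iff `qᵢ` is so. -/
theorem stmt_8 (I : Set ℝ) (hIopen : IsOpen I) (hIne : I.Nonempty)
    (hIconn : I.OrdConnected) (n : ℕ) (hn : 2 ≤ n) (k : ℕ) (hk : 1 ≤ k)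
    (f g : ℝ → ℝ)
    (hfc : ContinuousOn f I) (hgc : ContinuousOn g I)
    (hf : StrictMonoOn f I ∨ StrictAntiOn f I)
    (hg : StrictMonoOn g I ∨ StrictAntiOn g I)
    (finvf : ℝ → ℝ)
    (hfmaps : Set.MapsTo finvf (convexHull ℝ (f '' I)) I)
    (hfmono : MonotoneOn finvf (convexHull ℝ (f '' I)) ∨
      AntitoneOn finvf (convexHull ℝ (f '' I)))
    (hfleft : ∀ x ∈ I, finvf (f x) = x)
    (finvg : ℝ → ℝ)
    (hgmaps : Set.MapsTo finvg (convexHull ℝ (g '' I)) I)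
    (hgmono : MonotoneOn finvg (convexHull ℝ (g '' I)) ∨
      AntitoneOn finvg (convexHull ℝ (g '' I)))
    (hgleft : ∀ x ∈ I, finvg (g x) = x)
    (p q : Fin n → ℝ → ℝ)
    (hp : ∀ i, ∀ x ∈ I, 0 < p i x) (hq : ∀ i, ∀ x ∈ I, 0 < q i x)
    (U : Set (Fin n → ℝ)) (hUopen : IsOpen U)
    (hUsub : U ⊆ {y : Fin n → ℝ | ∀ i, y i ∈ I})
    (hUdiag : ∀ x ∈ I, Function.const (Fin n) x ∈ U)
    (heq : ∀ y ∈ U,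
      finvf ((∑ i, p i (y i) * f (y i)) / (∑ i, p i (y i))) =
      finvg ((∑ i, q i (y i) * g (y i)) / (∑ i, q i (y i))))
    (hf' : ∀ x ∈ I, deriv f x ≠ 0) (hg' : ∀ x ∈ I, deriv g x ≠ 0) :
    ((KTimesDiffOn k f I ∧ KTimesDiffOn k g I) →
      ∀ i, (KTimesDiffOn k (p i) I ↔ KTimesDiffOn k (q i) I)) ∧
    ((ContDiffOn ℝ k f I ∧ ContDiffOn ℝ k g I) →
      ∀ i, (ContDiffOn ℝ k (p i) I ↔ ContDiffOn ℝ k (q i) I)) := by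
  have hfinj : InjOn f I := hf.elim StrictMonoOn.injOn StrictAntiOn.injOn
  have hginj : InjOn g I := hg.elim StrictMonoOn.injOn StrictAntiOn.injOn
  have key : ∀ c : Prop, IterDiffOn c k f I → IterDiffOn c k g I →
      ∀ i, (IterDiffOn c k (p i) I ↔ IterDiffOn c k (q i) I) := fun c hfk hgk i =>
    ⟨IterDiffOn.weight_of_means_eq hk hn hIopen hIconn hfc hgc hf hginj hfleft hgleft hp hq
      hUopen hUdiag heq hf' hfk hgk,
    IterDiffOn.weight_of_means_eq hk hn hIopen hIconn hgc hfc hg hfinj hgleft hfleft hq hp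
      hUopen hUdiag (fun y hy => (heq y hy).symm) hg' hgk hfk⟩
  simp only [kTimesDiffOn_iff_iterDiffOn, contDiffOn_iff_iterDiffOn hIopen]
  exact ⟨fun h => key False h.1 h.2, fun h => key True h.1 h.2⟩
end

section
/- Let I be a nonempty open real interval, let f: I → ℝ be twice differentiable on I with nonvanishing first derivative, let p = (p_1,…,p_n): I → ℝ_+^n, and let i ∈ {1,…,n} such that p_i is continuously differentiable on I. Then the second-order partial derivative ∂_i² A_{f,p} exists at every point of diag(I^n), and for all x ∈ I, ∂_i² A_{f,p}(x,…,x) = 2 p_i'(x)(p_0(x) − p_i(x))/p_0(x)² + (p_i(x)(p_0(x) − p_i(x))/p_0(x)²)·(f''(x)/f'(x)), where p_0 = p_1 + … + p_n. -/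
/-- The `n`-variable generalized Bajraktarević mean built from `f`, its
generalized left inverse `finv`, and the weight functions `p`. -/
noncomputable def bmean {n : ℕ} (f finv : ℝ → ℝ) (p : Fin n → ℝ → ℝ)
    (x : Fin n → ℝ) : ℝ :=
  finv ((∑ i, p i (x i) * f (x i)) / ∑ i, p i (x i))

/-- A product of a continuous factor and a differentiable factor that vanishes at the point. -/
theorem HasDerivAt.continuousAt_mul_of_eq_zero {u v : ℝ → ℝ} {u' x : ℝ} (hu : HasDerivAt u u' x)
    (hux : u x = 0) (hv : ContinuousAt v x) : HasDerivAt (fun t => v t * u t) (v x * u') x := by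
  rw [hasDerivAt_iff_tendsto_slope] at hu ⊢
  refine ((hv.tendsto.mono_left nhdsWithin_le_nhds).mul hu).congr fun t => ?_
  simp only [slope_def_field, hux]
  ring

/-- A weighted arithmetic mean of values of a continuous function on an interval is a value. -/
theorem exists_eq_weighted_mean {ι : Type*} [Fintype ι] [Nonempty ι] {I : Set ℝ}
    (hI : I.OrdConnected) {f : ℝ → ℝ} (hf : ContinuousOn f I) {w y : ι → ℝ}
    (hw : ∀ l, 0 < w l) (hy : ∀ l, y l ∈ I) :
    ∃ a ∈ I, f a = (∑ l, w l * f (y l)) / ∑ l, w l := by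
  have hconv : Convex ℝ (f '' I) :=
    (hI.isPreconnected.image f hf).ordConnected.convex
  have h := hconv.centerMass_mem (t := Finset.univ) (w := w) (z := fun l => f (y l))
    (fun l _ => (hw l).le) (Finset.sum_pos (fun l _ => hw l) Finset.univ_nonempty)
    (fun l _ => Set.mem_image_of_mem f (hy l))
  obtain ⟨a, ha, hfa⟩ := h
  refine ⟨a, ha, hfa.trans ?_⟩
  simp only [Finset.centerMass, smul_eq_mul]
  ring

theorem Fintype.sum_update_eq_add_sum_erase {ι : Type*} [Fintype ι] [DecidableEq ι]
    (g : ι → ℝ → ℝ) (y : ι → ℝ) (i : ι) (t : ℝ) :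
    ∑ l, g l (Function.update y i t l) = g i t + ∑ l ∈ Finset.univ.erase i, g l (y l) := by
  rw [← Finset.add_sum_erase _ _ (Finset.mem_univ i), Function.update_self]
  congr 1
  exact Finset.sum_congr rfl fun l hl => by
    rw [Function.update_of_ne (Finset.ne_of_mem_erase hl)]

/-- The candidate for the `i`-th partial derivative of `bmean f finv p`. -/
noncomputable def bmeanPartial {n : ℕ} (f finv : ℝ → ℝ) (p : Fin n → ℝ → ℝ) (i : Fin n)
    (y : Fin n → ℝ) : ℝ :=
  (deriv (p i) (y i) * (f (y i) * ∑ l, p l (y l) - ∑ l, p l (y l) * f (y l)) +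
      p i (y i) * deriv f (y i) * ∑ l, p l (y l)) / (∑ l, p l (y l)) ^ 2 *
    (deriv f (bmean f finv p y))⁻¹

theorem hasDerivAt_bmean_update {I : Set ℝ} (hIopen : IsOpen I) (hIconn : I.OrdConnected) {n : ℕ}
    {f : ℝ → ℝ} (hfd : DifferentiableOn ℝ f I) (hfd2 : DifferentiableOn ℝ (deriv f) I)
    (hf' : ∀ x ∈ I, deriv f x ≠ 0) {finv : ℝ → ℝ} (hleft : ∀ x ∈ I, finv (f x) = x)
    {p : Fin n → ℝ → ℝ} (hp : ∀ l, ∀ x ∈ I, 0 < p l x) (i : Fin n)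
    (hpi : DifferentiableOn ℝ (p i) I) {y : Fin n → ℝ} (hy : ∀ l, y l ∈ I) :
    HasDerivAt (fun t => bmean f finv p (Function.update y i t))
      (bmeanPartial f finv p i y) (y i) := by
  have : Nonempty (Fin n) := ⟨i⟩
  have hdiff {g : ℝ → ℝ} (hg : DifferentiableOn ℝ g I) {x : ℝ} (hx : x ∈ I) :
      HasDerivAt g (deriv g x) x :=
    (hg.differentiableAt (hIopen.mem_nhds hx)).hasDerivAt
  obtain ⟨a, ha, hfa⟩ := exists_eq_weighted_mean hIconn hfd.continuousOn
    (fun l => hp l _ (hy l)) hy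
  have hmean : bmean f finv p y = a := by rw [bmean, ← hfa, hleft a ha]
  have hstrict : HasStrictDerivAt f (deriv f a) a := by
    refine hasStrictDerivAt_of_hasDerivAt_of_continuousAt ?_ (hdiff hfd2 ha).continuousAt
    filter_upwards [hIopen.mem_nhds ha] with x hx using hdiff hfd hx
  have hinv : HasDerivAt finv (deriv f a)⁻¹ (f a) := by
    refine (hstrict.to_local_left_inverse (hf' a ha) ?_).hasDerivAt
    filter_upwards [hIopen.mem_nhds ha] with x hx using hleft x hx
  have hD : HasDerivAt (fun t => ∑ l, p l (Function.update y i t l)) (deriv (p i) (y i)) (y i) := by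
    simp only [Fintype.sum_update_eq_add_sum_erase p]
    exact (hdiff hpi (hy i)).add_const _
  have hN : HasDerivAt
      (fun t => ∑ l, p l (Function.update y i t l) * f (Function.update y i t l))
      (deriv (p i) (y i) * f (y i) + p i (y i) * deriv f (y i)) (y i) := by
    simp only [Fintype.sum_update_eq_add_sum_erase fun l s => p l s * f s]
    exact ((hdiff hpi (hy i)).mul (hdiff hfd (hy i))).add_const _
  have hpos : 0 < ∑ l, p l (y l) := Finset.sum_pos (fun l _ => hp l _ (hy l)) Finset.univ_nonempty
  have hquot := hN.fun_div hD (by rw [Function.update_eq_self]; exact hpos.ne')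
  rw [hfa] at hinv
  have hcomp := HasDerivAt.comp (y i) (h₂ := finv) (h₂' := (deriv f a)⁻¹)
    (by simpa only [Function.update_eq_self] using hinv) hquot
  refine hcomp.congr_deriv ?_
  simp only [Function.update_eq_self, bmeanPartial, hmean]
  ring

theorem bmean_const {I : Set ℝ} {n : ℕ} {f finv : ℝ → ℝ} (hleft : ∀ x ∈ I, finv (f x) = x)
    {p : Fin n → ℝ → ℝ} {x : ℝ} (hx : x ∈ I) (hpos : ∑ l, p l x ≠ 0) :
    bmean f finv p (Function.const (Fin n) x) = x := by
  simp only [bmean, Function.const_apply]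
  rw [← Finset.sum_mul, mul_div_cancel_left₀ _ hpos, hleft x hx]

/-- Theorem DB (2b): if `f` is twice differentiable with nonvanishing first
derivative and `pᵢ` is continuously differentiable, then `∂ᵢ² A_{f,p}` exists
on the diagonal and equals `2pᵢ'(p₀−pᵢ)/p₀² + (pᵢ(p₀−pᵢ)/p₀²)·(f''/f')`. -/
theorem stmt_12 (I : Set ℝ) (hIopen : IsOpen I) (hIne : I.Nonempty)
    (hIconn : I.OrdConnected) (n : ℕ) (hn : 2 ≤ n) (f : ℝ → ℝ)
    (hfd : DifferentiableOn ℝ f I) (hfd2 : DifferentiableOn ℝ (deriv f) I)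
    (hf' : ∀ x ∈ I, deriv f x ≠ 0)
    (hf : StrictMonoOn f I ∨ StrictAntiOn f I) (finv : ℝ → ℝ)
    (hmaps : Set.MapsTo finv (convexHull ℝ (f '' I)) I)
    (hmono : MonotoneOn finv (convexHull ℝ (f '' I)) ∨
      AntitoneOn finv (convexHull ℝ (f '' I)))
    (hleft : ∀ x ∈ I, finv (f x) = x)
    (p : Fin n → ℝ → ℝ) (hp : ∀ l, ∀ x ∈ I, 0 < p l x)
    (i : Fin n) (hpi : ContDiffOn ℝ 1 (p i) I) :
    ∃ Pi : (Fin n → ℝ) → ℝ,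
      (∀ y : Fin n → ℝ, (∀ l, y l ∈ I) →
        HasDerivAt (fun t => bmean f finv p (Function.update y i t))
          (Pi y) (y i)) ∧
      (∀ x ∈ I,
        HasDerivAt
          (fun t => Pi (Function.update (Function.const (Fin n) x) i t))
          (2 * (deriv (p i) x * ((∑ l, p l x) - p i x) / (∑ l, p l x) ^ 2)
            + p i x * ((∑ l, p l x) - p i x) / (∑ l, p l x) ^ 2 *
              (deriv (deriv f) x / deriv f x)) x) := by
  have : Nonempty (Fin n) := ⟨i⟩
  have hpd : DifferentiableOn ℝ (p i) I := hpi.differentiableOn one_ne_zero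
  have hmain {y : Fin n → ℝ} (hy : ∀ l, y l ∈ I) :=
    hasDerivAt_bmean_update hIopen hIconn hfd hfd2 hf' hleft hp i hpd hy
  refine ⟨bmeanPartial f finv p i, fun y hy => hmain hy, fun x hx => ?_⟩
  have hdiff {g : ℝ → ℝ} (hg : DifferentiableOn ℝ g I) : HasDerivAt g (deriv g x) x :=
    (hg.differentiableAt (hIopen.mem_nhds hx)).hasDerivAt
  have hpos : 0 < ∑ l, p l x := Finset.sum_pos (fun l _ => hp l x hx) Finset.univ_nonempty
  have hfx := hf' x hx
  have hconst := bmean_const (f := f) hleft hx hpos.ne'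
  have hA := hmain (y := Function.const (Fin n) x) fun _ => hx
  set A : ℝ → ℝ :=
    fun t => bmean f finv p (Function.update (Function.const (Fin n) x) i t) with hAdef
  have hAx : A x = x := by
    have h : Function.update (Function.const (Fin n) x) i x = Function.const (Fin n) x :=
      Function.update_eq_self i (Function.const (Fin n) x)
    rw [hAdef]
    simp only [h, hconst]
  have hPx : bmeanPartial f finv p i (Function.const (Fin n) x) = p i x / ∑ l, p l x := by
    simp only [bmeanPartial, hconst, Function.const_apply, ← Finset.sum_mul]
    field_simp
    ring
  rw [hPx] at hA
  simp only [Function.const_apply] at hA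
  set d : ℝ := ∑ l ∈ Finset.univ.erase i, p l x with hd
  have hsum : ∑ l, p l x = p i x + d := (Finset.add_sum_erase _ _ (Finset.mem_univ i)).symm
  have hdf : HasDerivAt (fun t => d * (f t - f x)) (d * deriv f x) x :=
    ((hdiff hfd).sub_const _).const_mul d
  have hcont : ContinuousAt (deriv (p i)) x :=
    (hpi.continuousOn_deriv_of_isOpen hIopen le_rfl).continuousAt (hIopen.mem_nhds hx)
  have hfirst := hdf.continuousAt_mul_of_eq_zero (by simp) hcont
  have hD : HasDerivAt (fun t => p i t + d) (deriv (p i) x) x := (hdiff hpd).add_const d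
  have hfA : HasDerivAt (fun t => deriv f (A t))
      (deriv (deriv f) x * (p i x / ∑ l, p l x)) x :=
    HasDerivAt.comp x (h₂ := deriv f) (by rw [hAx]; exact hdiff hfd2) hA
  rw [hsum] at hpos hfA ⊢
  have htotal := ((hfirst.fun_add (((hdiff hpd).fun_mul (hdiff hfd2)).fun_mul hD)).fun_div
    (hD.fun_pow 2) (pow_ne_zero 2 hpos.ne')).fun_mul (hfA.fun_inv (by rwa [hAx]))
  refine (htotal.congr_deriv ?_).congr_of_eventuallyEq (.of_eq (funext fun t => ?_))
  · have := hpos.ne'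
    simp only [hAx]
    field_simp
    ring
  · simp only [bmeanPartial, Fintype.sum_update_eq_add_sum_erase p,
      Fintype.sum_update_eq_add_sum_erase fun l s => p l s * f s, Function.update_self,
      Function.const_apply, ← Finset.sum_mul, ← hd, hAdef]
    ring
end

section
/- Let I be a nonempty open real interval, let f: I → ℝ be three times differentiable on I with nonvanishing first derivative, let p = (p_1,…,p_n): I → ℝ_+^n, and let i, j, k ∈ {1,…,n} be pairwise distinct such that p_i, p_j, p_k are differentiable on I. Then the third-order mixed partial derivative ∂_i∂_j∂_k A_{f,p} exists, and for all x ∈ I, ∂_i∂_j∂_k A_{f,p}(x,…,x) = 2(p_i p_j' p_k' + p_i' p_j p_k' + p_i' p_j' p_k)(x)/p_0(x)³ + 2((p_i p_j p_k)'(x)/p_0(x)³)·(f''(x)/f'(x)) + (p_i(x)p_j(x)p_k(x)/p_0(x)³)·(3(f''(x)/f'(x))² − f'''(x)/f'(x)), where p_0 = p_1 + … + p_n. -/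
/-- The total weight `∑ l, p l (y l)`. -/
noncomputable def totalWeight {n : ℕ} (p : Fin n → ℝ → ℝ) (y : Fin n → ℝ) : ℝ :=
  ∑ l, p l (y l)

/-- The weighted average of the values `f (y l)`. -/
noncomputable def weightedAverage {n : ℕ} (f : ℝ → ℝ) (p : Fin n → ℝ → ℝ) (y : Fin n → ℝ) : ℝ :=
  (∑ l, p l (y l) * f (y l)) / ∑ l, p l (y l)

/-- The numerator of the `m`-th partial derivative of `weightedAverage f p`, whose denominator is
the total weight. -/
noncomputable def averageSlope {n : ℕ} (f : ℝ → ℝ) (p : Fin n → ℝ → ℝ) (m : Fin n)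
    (y : Fin n → ℝ) : ℝ :=
  deriv (p m) (y m) * (f (y m) - weightedAverage f p y) + p m (y m) * deriv f (y m)

lemma hasDerivAt_sum_update {n : ℕ} {q : Fin n → ℝ → ℝ} {y : Fin n → ℝ} {m : Fin n} {q' : ℝ}
    (h : HasDerivAt (q m) q' (y m)) :
    HasDerivAt (fun t => ∑ l, q l (Function.update y m t l)) q' (y m) := by
  have key : ∀ l ∈ Finset.univ, HasDerivAt (fun t => q l (Function.update y m t l))
      (if l = m then q' else 0) (y m) := by
    intro l _
    by_cases hl : l = m
    · subst hl
      simpa using h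
    · simpa [hl] using hasDerivAt_const (y m) (q l (y l))
  simpa using HasDerivAt.fun_sum key

lemma totalWeight_pos {n : ℕ} {I : Set ℝ} {p : Fin n → ℝ → ℝ} (hp : ∀ l, ∀ x ∈ I, 0 < p l x)
    (m : Fin n) {y : Fin n → ℝ} (hy : ∀ l, y l ∈ I) : 0 < totalWeight p y :=
  Finset.sum_pos (fun l _ => hp l _ (hy l)) ⟨m, Finset.mem_univ m⟩

lemma hasDerivAt_totalWeight {n : ℕ} {p : Fin n → ℝ → ℝ} {y : Fin n → ℝ} {m : Fin n}
    (h : DifferentiableAt ℝ (p m) (y m)) :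
    HasDerivAt (fun t => totalWeight p (Function.update y m t)) (deriv (p m) (y m)) (y m) :=
  hasDerivAt_sum_update h.hasDerivAt

lemma hasDerivAt_weightedAverage {n : ℕ} {f : ℝ → ℝ} {p : Fin n → ℝ → ℝ} {y : Fin n → ℝ}
    {m : Fin n} (hpos : 0 < totalWeight p y) (hp : DifferentiableAt ℝ (p m) (y m))
    (hf : DifferentiableAt ℝ f (y m)) :
    HasDerivAt (fun t => weightedAverage f p (Function.update y m t))
      (averageSlope f p m y / totalWeight p y) (y m) := by
  have hN := hasDerivAt_sum_update (q := fun l u => p l u * f u)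
    (hp.hasDerivAt.mul hf.hasDerivAt)
  have hne : ∑ l, p l (y l) ≠ 0 := hpos.ne'
  have h := hN.fun_div (hasDerivAt_totalWeight hp)
    (by simpa [totalWeight] using hne)
  refine h.congr_deriv ?_
  simp only [Function.update_eq_self, averageSlope, weightedAverage, totalWeight]
  field_simp
  ring

lemma hasDerivAt_averageSlope {n : ℕ} {f : ℝ → ℝ} {p : Fin n → ℝ → ℝ} {y : Fin n → ℝ}
    {m l : Fin n} (hlm : l ≠ m) (hpos : 0 < totalWeight p y)
    (hp : DifferentiableAt ℝ (p m) (y m)) (hf : DifferentiableAt ℝ f (y m)) :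
    HasDerivAt (fun t => averageSlope f p l (Function.update y m t))
      (-(deriv (p l) (y l) * averageSlope f p m y / totalWeight p y)) (y m) := by
  have h := (((hasDerivAt_weightedAverage hpos hp hf).const_sub (f (y l))).const_mul
    (deriv (p l) (y l))).add_const (p l (y l) * deriv f (y l))
  simp only [averageSlope, Function.update_of_ne hlm] at h ⊢
  exact h.congr_deriv (by ring)

lemma weightedAverage_mem_image {n : ℕ} {I : Set ℝ} (hI : I.OrdConnected) {f : ℝ → ℝ}
    (hf : ContinuousOn f I) {p : Fin n → ℝ → ℝ} (hp : ∀ l, ∀ x ∈ I, 0 < p l x) (m : Fin n)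
    {y : Fin n → ℝ} (hy : ∀ l, y l ∈ I) : weightedAverage f p y ∈ f '' I := by
  have hconv : Convex ℝ (f '' I) := (hI.isPreconnected.image f hf).ordConnected.convex
  have h := hconv.centerMass_mem (t := Finset.univ) (w := fun l => p l (y l))
    (z := fun l => f (y l)) (fun l _ => (hp l _ (hy l)).le) (totalWeight_pos hp m hy)
    (fun l _ => Set.mem_image_of_mem f (hy l))
  simpa [Finset.centerMass, weightedAverage, div_eq_inv_mul] using h

lemma bmean_mem {n : ℕ} {I : Set ℝ} (hI : I.OrdConnected) {f finv : ℝ → ℝ}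
    (hf : ContinuousOn f I) (hleft : ∀ x ∈ I, finv (f x) = x) {p : Fin n → ℝ → ℝ}
    (hp : ∀ l, ∀ x ∈ I, 0 < p l x) (m : Fin n) {y : Fin n → ℝ} (hy : ∀ l, y l ∈ I) :
    bmean f finv p y ∈ I ∧ f (bmean f finv p y) = weightedAverage f p y := by
  obtain ⟨a, ha, hfa⟩ := weightedAverage_mem_image hI hf hp m hy
  have hb : bmean f finv p y = a := by
    change finv (weightedAverage f p y) = a
    rw [← hfa, hleft a ha]
  rw [hb]
  exact ⟨ha, hfa⟩

lemma hasDerivAt_leftInverse {I : Set ℝ} (hI : IsOpen I) {f finv : ℝ → ℝ}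
    (hf : DifferentiableOn ℝ f I) (hf₂ : DifferentiableOn ℝ (deriv f) I)
    (hf' : ∀ x ∈ I, deriv f x ≠ 0) (hleft : ∀ x ∈ I, finv (f x) = x) {a : ℝ} (ha : a ∈ I) :
    HasDerivAt finv (deriv f a)⁻¹ (f a) := by
  have hnhds := hI.mem_nhds ha
  have hstrict : HasStrictDerivAt f (deriv f a) a := by
    refine hasStrictDerivAt_of_hasDerivAt_of_continuousAt ?_
      (hf₂.differentiableAt hnhds).continuousAt
    filter_upwards [hnhds] with x hx
    exact (hf.differentiableAt (hI.mem_nhds hx)).hasDerivAt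
  refine (hstrict.to_local_left_inverse (hf' a ha) ?_).hasDerivAt
  filter_upwards [hnhds] with x hx
  exact hleft x hx

lemma hasDerivAt_bmean {n : ℕ} {I : Set ℝ} (hIopen : IsOpen I) (hI : I.OrdConnected)
    {f finv : ℝ → ℝ} (hf : DifferentiableOn ℝ f I) (hf₂ : DifferentiableOn ℝ (deriv f) I)
    (hf' : ∀ x ∈ I, deriv f x ≠ 0) (hleft : ∀ x ∈ I, finv (f x) = x) {p : Fin n → ℝ → ℝ}
    (hp : ∀ l, ∀ x ∈ I, 0 < p l x) {m : Fin n} (hpm : DifferentiableOn ℝ (p m) I)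
    {y : Fin n → ℝ} (hy : ∀ l, y l ∈ I) :
    HasDerivAt (fun t => bmean f finv p (Function.update y m t))
      (averageSlope f p m y / (totalWeight p y * deriv f (bmean f finv p y))) (y m) := by
  obtain ⟨hmem, hfb⟩ := bmean_mem hI hf.continuousOn hleft hp m hy
  have hnhds := hIopen.mem_nhds (hy m)
  have hR := hasDerivAt_weightedAverage (totalWeight_pos hp m hy) (hpm.differentiableAt hnhds)
    (hf.differentiableAt hnhds)
  have hinv := hasDerivAt_leftInverse hIopen hf hf₂ hf' hleft hmem
  rw [hfb, ← Function.update_eq_self m y] at hinv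
  have h := HasDerivAt.comp (y m) hinv hR
  refine h.congr_deriv ?_
  rw [Function.update_eq_self]
  have := hf' _ hmem
  have := (totalWeight_pos hp m hy).ne'
  field_simp

/-- Theorem DB (3a): if `f` is three times differentiable with nonvanishing
first derivative and `pᵢ, pⱼ, p_k` (pairwise distinct indices) are
differentiable, then `∂ᵢ∂ⱼ∂ₖ A_{f,p}` exists on `Iⁿ` and on the diagonal equals
`2(pᵢpⱼ'pₖ'+pᵢ'pⱼpₖ'+pᵢ'pⱼ'pₖ)/p₀³ + 2(pᵢpⱼpₖ)'/p₀³·(f''/f')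
  + pᵢpⱼpₖ/p₀³·(3(f''/f')² − f'''/f')`. -/
theorem stmt_13 (I : Set ℝ) (hIopen : IsOpen I) (hIne : I.Nonempty)
    (hIconn : I.OrdConnected) (n : ℕ) (hn : 2 ≤ n) (f : ℝ → ℝ)
    (hfd : DifferentiableOn ℝ f I) (hfd2 : DifferentiableOn ℝ (deriv f) I)
    (hfd3 : DifferentiableOn ℝ (deriv (deriv f)) I)
    (hf' : ∀ x ∈ I, deriv f x ≠ 0)
    (hf : StrictMonoOn f I ∨ StrictAntiOn f I) (finv : ℝ → ℝ)
    (hmaps : Set.MapsTo finv (convexHull ℝ (f '' I)) I)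
    (hmono : MonotoneOn finv (convexHull ℝ (f '' I)) ∨
      AntitoneOn finv (convexHull ℝ (f '' I)))
    (hleft : ∀ x ∈ I, finv (f x) = x)
    (p : Fin n → ℝ → ℝ) (hp : ∀ l, ∀ x ∈ I, 0 < p l x)
    (i j k : Fin n) (hij : i ≠ j) (hjk : j ≠ k) (hik : i ≠ k)
    (hpi : DifferentiableOn ℝ (p i) I) (hpj : DifferentiableOn ℝ (p j) I)
    (hpk : DifferentiableOn ℝ (p k) I) :
    ∃ P1 P2 P3 : (Fin n → ℝ) → ℝ,
      (∀ y : Fin n → ℝ, (∀ l, y l ∈ I) →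
        HasDerivAt (fun t => bmean f finv p (Function.update y k t))
          (P1 y) (y k)) ∧
      (∀ y : Fin n → ℝ, (∀ l, y l ∈ I) →
        HasDerivAt (fun t => P1 (Function.update y j t)) (P2 y) (y j)) ∧
      (∀ y : Fin n → ℝ, (∀ l, y l ∈ I) →
        HasDerivAt (fun t => P2 (Function.update y i t)) (P3 y) (y i)) ∧
      (∀ x ∈ I,
        P3 (Function.const (Fin n) x) =
          2 * (p i x * deriv (p j) x * deriv (p k) x
              + deriv (p i) x * p j x * deriv (p k) x
              + deriv (p i) x * deriv (p j) x * p k x) / (∑ l, p l x) ^ 3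
          + 2 * (deriv (fun u => p i u * p j u * p k u) x / (∑ l, p l x) ^ 3)
              * (deriv (deriv f) x / deriv f x)
          + p i x * p j x * p k x / (∑ l, p l x) ^ 3 *
              (3 * (deriv (deriv f) x / deriv f x) ^ 2
                - deriv (deriv (deriv f)) x / deriv f x)) := by
  set A : (Fin n → ℝ) → ℝ := bmean f finv p
  set D : (Fin n → ℝ) → ℝ := totalWeight p
  set w : Fin n → (Fin n → ℝ) → ℝ := averageSlope f p with hw
  have hD0 : ∀ y : Fin n → ℝ, (∀ l, y l ∈ I) → D y ≠ 0 := fun y hy => (totalWeight_pos hp i hy).ne'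
  have hAI : ∀ y : Fin n → ℝ, (∀ l, y l ∈ I) → A y ∈ I := fun y hy =>
    (bmean_mem hIconn hfd.continuousOn hleft hp i hy).1
  have hfA : ∀ y : Fin n → ℝ, (∀ l, y l ∈ I) → deriv f (A y) ≠ 0 := fun y hy => hf' _ (hAI y hy)
  have dA : ∀ m, DifferentiableOn ℝ (p m) I → ∀ y : Fin n → ℝ, (∀ l, y l ∈ I) →
      HasDerivAt (fun t => A (Function.update y m t)) (w m y / (D y * deriv f (A y))) (y m) :=
    fun m hm y hy => hasDerivAt_bmean hIopen hIconn hfd hfd2 hf' hleft hp hm hy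
  have dD : ∀ m, DifferentiableOn ℝ (p m) I → ∀ y : Fin n → ℝ, (∀ l, y l ∈ I) →
      HasDerivAt (fun t => D (Function.update y m t)) (deriv (p m) (y m)) (y m) :=
    fun m hm y hy => hasDerivAt_totalWeight (hm.differentiableAt (hIopen.mem_nhds (hy m)))
  have dw : ∀ m l, l ≠ m → DifferentiableOn ℝ (p m) I → ∀ y : Fin n → ℝ, (∀ l, y l ∈ I) →
      HasDerivAt (fun t => w l (Function.update y m t))
        (-(deriv (p l) (y l) * w m y / D y)) (y m) :=
    fun m l hlm hm y hy => hasDerivAt_averageSlope hlm (totalWeight_pos hp m hy)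
      (hm.differentiableAt (hIopen.mem_nhds (hy m)))
      (hfd.differentiableAt (hIopen.mem_nhds (hy m)))
  have df : ∀ g : ℝ → ℝ, DifferentiableOn ℝ g I → ∀ m, DifferentiableOn ℝ (p m) I →
      ∀ y : Fin n → ℝ, (∀ l, y l ∈ I) →
      HasDerivAt (fun t => g (A (Function.update y m t)))
        (deriv g (A y) * (w m y / (D y * deriv f (A y)))) (y m) := by
    intro g hg m hm y hy
    have hg' := (hg.differentiableAt (hIopen.mem_nhds (hAI y hy))).hasDerivAt
    rw [← Function.update_eq_self m y] at hg'
    have h := HasDerivAt.comp (y m) hg' (dA m hm y hy)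
    rwa [Function.update_eq_self] at h
  refine ⟨fun y => w k y / (D y * deriv f (A y)),
    fun y => -((deriv (p k) (y k) * w j y + deriv (p j) (y j) * w k y) * deriv f (A y) ^ 2
      + w k y * w j y * deriv (deriv f) (A y)) / (D y ^ 2 * deriv f (A y) ^ 3),
    fun y => -((((deriv (p k) (y k) * (-(deriv (p j) (y j) * w i y / D y))
            + deriv (p j) (y j) * (-(deriv (p k) (y k) * w i y / D y))) * deriv f (A y) ^ 2
          + (deriv (p k) (y k) * w j y + deriv (p j) (y j) * w k y)
            * (2 * deriv f (A y) * (deriv (deriv f) (A y) * (w i y / (D y * deriv f (A y)))))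
          + ((-(deriv (p k) (y k) * w i y / D y)) * w j y
              + w k y * (-(deriv (p j) (y j) * w i y / D y))) * deriv (deriv f) (A y)
          + w k y * w j y
            * (deriv (deriv (deriv f)) (A y) * (w i y / (D y * deriv f (A y)))))
        * (D y ^ 2 * deriv f (A y) ^ 3)
      - ((deriv (p k) (y k) * w j y + deriv (p j) (y j) * w k y) * deriv f (A y) ^ 2
          + w k y * w j y * deriv (deriv f) (A y))
        * (2 * D y * deriv (p i) (y i) * deriv f (A y) ^ 3
          + D y ^ 2 * (3 * deriv f (A y) ^ 2
            * (deriv (deriv f) (A y) * (w i y / (D y * deriv f (A y)))))))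
      / (D y ^ 2 * deriv f (A y) ^ 3) ^ 2),
    dA k hpk, ?_, ?_, ?_⟩
  · intro y hy
    have := hD0 y hy
    have := hfA y hy
    have h := (dw j k hjk.symm hpj y hy).fun_div
      ((dD j hpj y hy).fun_mul (df _ hfd2 j hpj y hy)) 
      (by simpa only [Function.update_eq_self] using mul_ne_zero (hD0 y hy) (hfA y hy))
    refine h.congr_deriv ?_
    simp only [Function.update_eq_self]
    field_simp
    ring
  · intro y hy
    have hdk := dw i k hik.symm hpi y hy
    have hdj := dw i j hij.symm hpi y hy
    have hF := df _ hfd2 i hpi y hy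
    have hG := df _ hfd3 i hpi y hy
    have hnum := (((hdj.const_mul (deriv (p k) (y k))).fun_add
      (hdk.const_mul (deriv (p j) (y j)))).fun_mul (hF.fun_pow 2)).fun_add
        ((hdk.fun_mul hdj).fun_mul hG)
    have hden := ((dD i hpi y hy).fun_pow 2).fun_mul (hF.fun_pow 3)
    have h := hnum.fun_neg.fun_div hden (by
      simpa only [Function.update_eq_self] using
        mul_ne_zero (pow_ne_zero 2 (hD0 y hy)) (pow_ne_zero 3 (hfA y hy)))
    simp only [Function.update_of_ne hij.symm, Function.update_of_ne hik.symm]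
    refine h.congr_deriv ?_
    simp only [Function.update_eq_self]
    push_cast
    ring
  · intro x hx
    have hy : ∀ l, Function.const (Fin n) x l ∈ I := fun _ => hx
    have hDx : D (Function.const (Fin n) x) = ∑ l, p l x := rfl
    have hne : ∑ l, p l x ≠ 0 := hD0 _ hy
    have hR : weightedAverage f p (Function.const (Fin n) x) = f x := by
      simp only [weightedAverage, Function.const_apply, ← Finset.sum_mul]
      exact mul_div_cancel_left₀ _ hne
    have hAx : A (Function.const (Fin n) x) = x := by
      change finv (weightedAverage f p (Function.const (Fin n) x)) = x
      rw [hR, hleft x hx]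
    have hwx : ∀ m, w m (Function.const (Fin n) x) = p m x * deriv f x := by
      intro m
      simp [hw, averageSlope, hR]
    have hnhds := hIopen.mem_nhds hx
    have hprod := (((hpi.differentiableAt hnhds).hasDerivAt.fun_mul
      (hpj.differentiableAt hnhds).hasDerivAt).fun_mul
        (hpk.differentiableAt hnhds).hasDerivAt).deriv
    have hfx := hf' x hx
    simp only [hDx, hAx, hwx, hprod, Function.const_apply]
    generalize ∑ l, p l x = S at hne ⊢
    field_simp
    ring
end
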